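/- Let D be a k-ary strongly first order, relativizable generalized dependency and let θ(x̄, ȳ) be a first-order formula over the empty signature, where x̄ is a tuple of k distinct variables. Then the dependency D_θ = {(M,R) ∈ D : (M,R) ⊨ ∃ȳ ∀x̄ (R x̄ → θ(x̄, ȳ))} is also strongly first order and relativizable. -/

import Mathlib

namespace DSFO

/-- A purely relational signature: for each arity, a type of relation symbols. -/
abbrev Signature := ℕ → Type

/-- The empty signature. -/
def Sig0 : Signature := fun _ => Empty

/-- The signature with a single `k`-ary relation symbol `R`. -/
def SigR (k : ℕ) : Signature := fun n => PLift (n = k)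

/-- Syntax of team-semantics formulas (in negation normal form, with the two
additional connectives: global disjunction `gdisj` and contradictory negation
`cneg`) over a relational signature `S`, with generalized dependency atoms
indexed by `ι` with arities `ar`.  Variables are natural numbers. -/
inductive TS (S : Signature) (ι : Type) (ar : ι → ℕ) : Type
  | rel {k : ℕ} (r : S k) (v : Fin k → ℕ)
  | nrel {k : ℕ} (r : S k) (v : Fin k → ℕ)
  | eq (x y : ℕ)
  | neq (x y : ℕ)
  | dep (i : ι) (v : Fin (ar i) → ℕ)
  | and (φ ψ : TS S ι ar)
  | or (φ ψ : TS S ι ar)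
  | gdisj (φ ψ : TS S ι ar)
  | cneg (φ : TS S ι ar)
  | ex (v : ℕ) (φ : TS S ι ar)
  | al (v : ℕ) (φ : TS S ι ar)

/-- The always-true literal `⊤`. -/
def TS.top {S : Signature} {ι : Type} {ar : ι → ℕ} : TS S ι ar := .eq 0 0

/-- The arity function for "no dependency atoms". -/
def noAtoms : Empty → ℕ := fun e => e.elim

/-- First-order formulas over `S` (no dependency atoms; here `cneg` plays the
role of ordinary classical negation and `gdisj` of ordinary disjunction, so
this is full first-order logic). -/
abbrev FOF (S : Signature) := TS S Empty noAtoms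

/-- First-order formulas over the empty signature. -/
abbrev EF := FOF Sig0

/-- Free variables of a formula. -/
def fv {S : Signature} {ι : Type} {ar : ι → ℕ} : TS S ι ar → Set ℕ
  | .rel _ v => Set.range v
  | .nrel _ v => Set.range v
  | .eq x y => {x, y}
  | .neq x y => {x, y}
  | .dep _ v => Set.range v
  | .and φ ψ => fv φ ∪ fv ψ
  | .or φ ψ => fv φ ∪ fv ψ
  | .gdisj φ ψ => fv φ ∪ fv ψ
  | .cneg φ => fv φ
  | .ex v φ => fv φ \ {v}
  | .al v φ => fv φ \ {v}

/-- A sentence is a formula with no free variables. -/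
def IsSentence {S : Signature} {ι : Type} {ar : ι → ℕ} (φ : TS S ι ar) : Prop :=
  fv φ = ∅

/-- No global disjunctions occur. -/
def NoGdisj {S : Signature} {ι : Type} {ar : ι → ℕ} : TS S ι ar → Prop
  | .rel _ _ => True
  | .nrel _ _ => True
  | .eq _ _ => True
  | .neq _ _ => True
  | .dep _ _ => True
  | .and φ ψ => NoGdisj φ ∧ NoGdisj ψ
  | .or φ ψ => NoGdisj φ ∧ NoGdisj ψ
  | .gdisj _ _ => False
  | .cneg φ => NoGdisj φ
  | .ex _ φ => NoGdisj φ
  | .al _ φ => NoGdisj φ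

/-- No contradictory negations occur. -/
def NoCneg {S : Signature} {ι : Type} {ar : ι → ℕ} : TS S ι ar → Prop
  | .rel _ _ => True
  | .nrel _ _ => True
  | .eq _ _ => True
  | .neq _ _ => True
  | .dep _ _ => True
  | .and φ ψ => NoCneg φ ∧ NoCneg ψ
  | .or φ ψ => NoCneg φ ∧ NoCneg ψ
  | .gdisj φ ψ => NoCneg φ ∧ NoCneg ψ
  | .cneg _ => False
  | .ex _ φ => NoCneg φ
  | .al _ φ => NoCneg φ

/-- Formulas of `FO(𝒟)` proper: no `gdisj` and no `cneg`. -/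
def Plain {S : Signature} {ι : Type} {ar : ι → ℕ} (φ : TS S ι ar) : Prop :=
  NoCneg φ ∧ NoGdisj φ

/-- Atomic formulas: first-order literals and dependency atoms. -/
def Atomic {S : Signature} {ι : Type} {ar : ι → ℕ} : TS S ι ar → Prop
  | .rel _ _ => True
  | .nrel _ _ => True
  | .eq _ _ => True
  | .neq _ _ => True
  | .dep _ _ => True
  | _ => False

/-- Formulas of `FO(∼₀, 𝒟)`: the contradictory negation may appear only in
front of first-order literals and dependency atoms (and there is no `gdisj`). -/
def Cneg0 {S : Signature} {ι : Type} {ar : ι → ℕ} : TS S ι ar → Prop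
  | .rel _ _ => True
  | .nrel _ _ => True
  | .eq _ _ => True
  | .neq _ _ => True
  | .dep _ _ => True
  | .and φ ψ => Cneg0 φ ∧ Cneg0 ψ
  | .or φ ψ => Cneg0 φ ∧ Cneg0 ψ
  | .gdisj _ _ => False
  | .cneg φ => Atomic φ
  | .ex _ φ => Cneg0 φ
  | .al _ φ => Cneg0 φ

/-- The negation normal form of the (dual) negation of a formula. -/
def TS.nneg {S : Signature} {ι : Type} {ar : ι → ℕ} : TS S ι ar → TS S ι ar
  | .rel r v => .nrel r v
  | .nrel r v => .rel r v
  | .eq x y => .neq x y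
  | .neq x y => .eq x y
  | .dep i v => .cneg (.dep i v)
  | .and φ ψ => .or (TS.nneg φ) (TS.nneg ψ)
  | .or φ ψ => .and (TS.nneg φ) (TS.nneg ψ)
  | .gdisj φ ψ => .and (TS.nneg φ) (TS.nneg ψ)
  | .cneg φ => φ
  | .ex v φ => .al v (TS.nneg φ)
  | .al v φ => .ex v (TS.nneg φ)

/-- Iterated existential quantification over a list of variables. -/
def exs {S : Signature} {ι : Type} {ar : ι → ℕ} (l : List ℕ) (φ : TS S ι ar) :
    TS S ι ar := l.foldr TS.ex φ

/-- An interpretation of a relational signature in a domain `M`. -/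
abbrev Interp (S : Signature) (M : Type) := ∀ k, S k → Set (Fin k → M)

/-- The unique interpretation of the empty signature. -/
def eI (M : Type) : Interp Sig0 M := fun _ e => e.elim

/-- The interpretation of `SigR k` given by a `k`-ary relation `R`. -/
def interpR {k : ℕ} {M : Type} (R : Set (Fin k → M)) : Interp (SigR k) M :=
  fun _ r => {s | (fun i => s (Fin.cast r.down.symm i)) ∈ R}

/-- Tarskian (single-assignment) satisfaction.  Dependency atoms are
(vacuously) interpreted as true; this is only used on first-order formulas. -/
def FSat {S : Signature} {ι : Type} {ar : ι → ℕ} (M : Type) (I : Interp S M) :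
    (ℕ → M) → TS S ι ar → Prop
  | s, .rel r v => (fun i => s (v i)) ∈ I _ r
  | s, .nrel r v => (fun i => s (v i)) ∉ I _ r
  | s, .eq x y => s x = s y
  | s, .neq x y => s x ≠ s y
  | _, .dep _ _ => True
  | s, .and φ ψ => FSat M I s φ ∧ FSat M I s ψ
  | s, .or φ ψ => FSat M I s φ ∨ FSat M I s ψ
  | s, .gdisj φ ψ => FSat M I s φ ∨ FSat M I s ψ
  | s, .cneg φ => ¬ FSat M I s φ
  | s, .ex v φ => ∃ m : M, FSat M I (Function.update s v m) φ
  | s, .al v φ => ∀ m : M, FSat M I (Function.update s v m) φ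

/-- Truth of a first-order sentence (Tarskian semantics). -/
def FOTrue {S : Signature} {ι : Type} {ar : ι → ℕ} (M : Type) (I : Interp S M)
    (φ : TS S ι ar) : Prop :=
  ∀ s : ℕ → M, FSat M I s φ

/-- The relation `X(x̄)` determined by a team `X` and a tuple of variables `x̄`. -/
def teamProj {M : Type} {k : ℕ} (v : Fin k → ℕ) (X : Set (ℕ → M)) :
    Set (Fin k → M) := {t | ∃ s ∈ X, t = fun j => s (v j)}

/-- (Lax) team semantics.  `A` gives the semantics of each dependency atom as a
function of the relation `X(x̄)`. -/
def TSat {S : Signature} {ι : Type} {ar : ι → ℕ} (M : Type) (I : Interp S M)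
    (A : ∀ i, Set (Fin (ar i) → M) → Prop) :
    TS S ι ar → Set (ℕ → M) → Prop
  | .rel r v, X => ∀ s ∈ X, (fun i => s (v i)) ∈ I _ r
  | .nrel r v, X => ∀ s ∈ X, (fun i => s (v i)) ∉ I _ r
  | .eq x y, X => ∀ s ∈ X, s x = s y
  | .neq x y, X => ∀ s ∈ X, s x ≠ s y
  | .dep i v, X => A i (teamProj v X)
  | .and φ ψ, X => TSat M I A φ X ∧ TSat M I A ψ X
  | .or φ ψ, X => ∃ Y Z : Set (ℕ → M), Y ∪ Z = X ∧ TSat M I A φ Y ∧ TSat M I A ψ Z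
  | .gdisj φ ψ, X => TSat M I A φ X ∨ TSat M I A ψ X
  | .cneg φ, X => ¬ TSat M I A φ X
  | .ex v φ, X => ∃ H : (ℕ → M) → Set M, (∀ s ∈ X, (H s).Nonempty) ∧
      TSat M I A φ {s' | ∃ s ∈ X, ∃ m ∈ H s, s' = Function.update s v m}
  | .al v φ, X => TSat M I A φ {s' | ∃ s ∈ X, ∃ m : M, s' = Function.update s v m}

/-- Truth of a sentence under team semantics: satisfaction by the team of all
assignments (by locality, equivalent to satisfaction by `{∅}`). -/
def TTrue {S : Signature} {ι : Type} {ar : ι → ℕ} (M : Type) (I : Interp S M)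
    (A : ∀ i, Set (Fin (ar i) → M) → Prop) (φ : TS S ι ar) : Prop :=
  TSat M I A φ Set.univ

/-- A `k`-ary dependency predicate: a class of pairs `(M, R)`. -/
abbrev DepPred (k : ℕ) := ∀ M : Type, Set (Fin k → M) → Prop

/-- Closure under isomorphisms (part of the definition of a generalized
dependency). -/
def IsoClosed {k : ℕ} (D : DepPred k) : Prop :=
  ∀ (M N : Type) (e : M ≃ N) (R : Set (Fin k → M)),
    D M R → D N ((fun f => e ∘ f) '' R)

/-- The complement `∼D` of a dependency. -/
def complD {k : ℕ} (D : DepPred k) : DepPred k := fun M R => ¬ D M R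

def DownwardsClosed {k : ℕ} (D : DepPred k) : Prop :=
  ∀ (M : Type) (R R' : Set (Fin k → M)), D M R → R' ⊆ R → D M R'

/-- The downwards closure `D↓`. -/
def dClosure {k : ℕ} (D : DepPred k) : DepPred k :=
  fun M R => ∃ R', R ⊆ R' ∧ D M R'

/-- `D_max`: the maximal models of `D`. -/
def DMax {k : ℕ} (D : DepPred k) : DepPred k :=
  fun M R => D M R ∧ ∀ R', R ⊂ R' → ¬ D M R'

/-- The empty team property. -/
def EmptyTeamProp {k : ℕ} (D : DepPred k) : Prop :=
  ∀ M : Type, Nontrivial M → D M (∅ : Set (Fin k → M))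

/-- `D` is a first-order dependency: it is the class of models of a first-order
sentence over the signature `{R}`. -/
def FirstOrderDep {k : ℕ} (D : DepPred k) : Prop :=
  ∃ ψ : FOF (SigR k), IsSentence ψ ∧
    ∀ (M : Type), Nontrivial M → ∀ R : Set (Fin k → M),
      (D M R ↔ FOTrue M (interpR R) ψ)

/-- The interpretation of a unary predicate symbol as a subset of the domain. -/
def PSet {S : Signature} {M : Type} (I : Interp S M) (P : S 1) : Set M :=
  {m | (fun _ => m) ∈ I 1 P}

/-- Semantics of the relativization `D^(P)` of `D` to the unary predicate `P`:
`𝔐 ⊨_X D^(P) x̄` iff `(P^𝔐, X(x̄)) ∈ D`. -/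
def relSem {k : ℕ} (D : DepPred k) {S : Signature} (P : S 1)
    (M : Type) (I : Interp S M) (R : Set (Fin k → M)) : Prop :=
  (∀ f ∈ R, ∀ j, f j ∈ PSet I P) ∧
    D (↥(PSet I P)) {g : Fin k → ↥(PSet I P) | (fun j => (g j : M)) ∈ R}

/-- A family `𝒟` of generalized dependencies is strongly first order: every
sentence of `FO(𝒟)` is equivalent to some first-order sentence. -/
def SFOFam {ι : Type} {ar : ι → ℕ} (D : ∀ i, DepPred (ar i)) : Prop :=
  ∀ (S : Signature) (φ : TS S ι ar), IsSentence φ → Plain φ →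
    ∃ ψ : FOF S, IsSentence ψ ∧
      ∀ (M : Type), Nontrivial M → ∀ I : Interp S M,
        (TTrue M I (fun i => D i M) φ ↔ FOTrue M I ψ)

/-- A single dependency is strongly first order iff `{D}` is. -/
def SFOd {k : ℕ} (D : DepPred k) : Prop :=
  SFOFam (ι := Unit) (ar := fun _ => k) (fun _ => D)

/-- A family `𝒟` is relativizable: every sentence of `FO(𝒟^(P))` is equivalent
to some sentence of `FO(𝒟)`. -/
def RelativizableFam {ι : Type} {ar : ι → ℕ} (D : ∀ i, DepPred (ar i)) : Prop :=
  ∀ (S : Signature) (P : S 1) (φ : TS S ι ar), IsSentence φ → Plain φ →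
    ∃ ψ : TS S ι ar, IsSentence ψ ∧ Plain ψ ∧
      ∀ (M : Type), Nontrivial M → ∀ I : Interp S M,
        (TTrue M I (fun i => relSem (D i) P M I) φ ↔ TTrue M I (fun i => D i M) ψ)

def Relativizable1 {k : ℕ} (D : DepPred k) : Prop :=
  RelativizableFam (ι := Unit) (ar := fun _ => k) (fun _ => D)

/-- The family `𝒟 ∪ ∼𝒟`. -/
def withComplFam {ι : Type} {ar : ι → ℕ} (D : ∀ i, DepPred (ar i)) :
    ∀ i : ι ⊕ ι, DepPred (Sum.elim ar ar i) :=
  fun i => match i with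
    | .inl a => D a
    | .inr a => complD (D a)

/-- `D` is doubly strongly first order: `{D, ∼D}` is strongly first order. -/
def DSFOd {k : ℕ} (D : DepPred k) : Prop :=
  SFOFam (ι := Bool) (ar := fun _ => k)
    (fun b => match b with | true => D | false => complD D)

/-- The constancy atom of arity `k`. -/
def constD (k : ℕ) : DepPred k := fun _ R => ∀ f ∈ R, ∀ g ∈ R, f = g

/-- The totality atom of arity `k`. -/
def allD (k : ℕ) : DepPred k := fun M R => R = (Set.univ : Set (Fin k → M))

/-- The family `𝒟 ∪ {const}` (constancy atoms of every arity). -/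
def withConst {ι : Type} {ar : ι → ℕ} (D : ∀ i, DepPred (ar i)) :
    ∀ i : ι ⊕ ℕ, DepPred (Sum.elim ar id i) :=
  fun i => match i with
    | .inl a => D a
    | .inr n => constD n

/-- The atoms of `𝒟^(P) ∪ {const}`. -/
def withConstRel {ι : Type} {ar : ι → ℕ} (D : ∀ i, DepPred (ar i))
    {S : Signature} (P : S 1) (M : Type) (I : Interp S M) :
    ∀ i : ι ⊕ ℕ, Set (Fin (Sum.elim ar id i) → M) → Prop :=
  fun i => match i with
    | .inl a => relSem (D a) P M I
    | .inr n => constD n M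

/-- Atom indices of the logic `FO(𝒟₀, ⊔, const, All)`: the 0-ary first-order
dependencies `[ψ]`, the constancy atoms and the totality atoms. -/
inductive CIdx : Type
  | d0 (ψ : EF) (hψ : IsSentence ψ)
  | const (k : ℕ)
  | total (k : ℕ)

def cAr : CIdx → ℕ
  | .d0 _ _ => 0
  | .const k => k
  | .total k => k

def cSem (M : Type) : ∀ i : CIdx, Set (Fin (cAr i) → M) → Prop
  | .d0 ψ _, _ => FOTrue M (eI M) ψ
  | .const _, R => ∀ f ∈ R, ∀ g ∈ R, f = g
  | .total _, R => R = Set.univ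

/-- Embedding of first-order formulas over the empty signature into any
team logic. -/
def embedEF {S : Signature} {ι : Type} {ar : ι → ℕ} : EF → TS S ι ar
  | .rel r _ => Empty.elim r
  | .nrel r _ => Empty.elim r
  | .eq x y => .eq x y
  | .neq x y => .neq x y
  | .dep i _ => Empty.elim i
  | .and φ ψ => .and (embedEF φ) (embedEF ψ)
  | .or φ ψ => .or (embedEF φ) (embedEF ψ)
  | .gdisj φ ψ => .gdisj (embedEF φ) (embedEF ψ)
  | .cneg φ => .cneg (embedEF φ)
  | .ex v φ => .ex v (embedEF φ)
  | .al v φ => .al v (embedEF φ)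

/-- Override the values of the variables `0, …, k-1` by the tuple `f`. -/
def overrideFin {M : Type} (k : ℕ) (f : Fin k → M) (s : ℕ → M) : ℕ → M :=
  fun v => if h : v < k then f ⟨v, h⟩ else s v

/-- `(M, R) ⊨ ∃ȳ ∀x̄ (R x̄ → θ(x̄, ȳ))`, where `x̄` is the tuple of variables
`0, …, k-1` and the remaining free variables `ȳ` of `θ` are witnessed by `s`. -/
def ExAllSem {k : ℕ} (M : Type) (R : Set (Fin k → M)) (θ : EF) : Prop :=
  ∃ s : ℕ → M, ∀ f ∈ R, FSat M (eI M) (overrideFin k f s) θ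

/-- `(M, R) ⊨ ∃ȳ ∀x̄ (R x̄ ↔ θ(x̄, ȳ))`. -/
def ExAllIffSem {k : ℕ} (M : Type) (R : Set (Fin k → M)) (θ : EF) : Prop :=
  ∃ s : ℕ → M, ∀ f : Fin k → M, (f ∈ R ↔ FSat M (eI M) (overrideFin k f s) θ)

/-- The assignment sending `x̄ = (0, …, k-1)` to `f`, `ȳ = (k, …, k+n-1)` to
`a`, and every other variable to its value under `s0`. -/
def tupAsg {M : Type} (k n : ℕ) (f : Fin k → M) (a : Fin n → M) (s0 : ℕ → M) :
    ℕ → M :=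
  fun v => if h : v < k then f ⟨v, h⟩ else if h2 : v - k < n then a ⟨v - k, h2⟩ else s0 v

/-- `R` is defined by the formula `θ(x̄, ȳ)` (with `x̄ = (0, …, k-1)` and
`ȳ = (k, …, k+n-1)`): there is a tuple `ā` of parameters such that
`R = {m̄ : 𝔐 ⊨ θ(m̄, ā)}`. -/
def DefinedBy {S : Signature} {M : Type} (I : Interp S M) (k n : ℕ)
    (θ : FOF S) (R : Set (Fin k → M)) : Prop :=
  ∃ a : Fin n → M, ∀ s0 : ℕ → M, R = {f | FSat M I (tupAsg k n f a s0) θ}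

/-- `θ(x̄, ȳ)` fixes the identity type of `ȳ = (k, …, k+n-1)`. -/
def FixesIdType {S : Signature} (k n : ℕ) (θ : FOF S) : Prop :=
  ∀ i j : Fin n,
    (∀ (M : Type), Nontrivial M → ∀ (I : Interp S M) (s : ℕ → M),
        FSat M I s θ → s (k + (i : ℕ)) = s (k + (j : ℕ))) ∨
    (∀ (M : Type), Nontrivial M → ∀ (I : Interp S M) (s : ℕ → M),
        FSat M I s θ → s (k + (i : ℕ)) ≠ s (k + (j : ℕ)))

/-- `(M, R := Xv) ⊨ ∃ȳ ∀x̄ (R x̄ → θ(x̄, ȳ))` where the `x̄`-slots of `θ` are the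
variables `v̄` and the `ȳ`-slots are the variables `ȳ`. -/
def projExAll {M : Type} {k n : ℕ} (v : Fin k → ℕ) (y : Fin n → ℕ) (θ : EF)
    (Xv : Set (Fin k → M)) : Prop :=
  ∃ b : Fin n → M, ∀ f ∈ Xv, ∀ s : ℕ → M,
    (∀ j, s (v j) = f j) → (∀ i, s (y i) = b i) → FSat M (eI M) s θ


section FirstOrder

variable {S : Signature} {M : Type}

theorem fv_finite {ι : Type} {ar : ι → ℕ} (φ : TS S ι ar) : (fv φ).Finite := by
  induction φ with
  | rel r v => exact Set.finite_range v
  | nrel r v => exact Set.finite_range v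
  | eq x y => exact Set.toFinite {x, y}
  | neq x y => exact Set.toFinite {x, y}
  | dep i v => exact Set.finite_range v
  | and φ ψ h₁ h₂ => exact h₁.union h₂
  | or φ ψ h₁ h₂ => exact h₁.union h₂
  | gdisj φ ψ h₁ h₂ => exact h₁.union h₂
  | cneg φ h => exact h
  | ex v φ h => exact h.sdiff
  | al v φ h => exact h.sdiff

theorem update_eq_of_mem_diff {N : Type} {F : Set ℕ} {v : ℕ} {s t : ℕ → N}
    (h : ∀ x ∈ F \ {v}, s x = t x) (m : N) :
    ∀ x ∈ F, Function.update s v m x = Function.update t v m x := by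
  intro x hx
  by_cases hxv : x = v
  · subst hxv; simp
  · simpa [hxv] using h x ⟨hx, hxv⟩

/-- Tarskian satisfaction depends only on the values of the free variables. -/
theorem FSat_congr (I : Interp S M) (φ : FOF S) {s t : ℕ → M}
    (h : ∀ x ∈ fv φ, s x = t x) : FSat M I s φ ↔ FSat M I t φ := by
  induction φ generalizing s t with
  | rel r v =>
    have : (fun i => s (v i)) = fun i => t (v i) := funext fun i => h _ ⟨i, rfl⟩
    simp only [FSat, this]
  | nrel r v =>
    have : (fun i => s (v i)) = fun i => t (v i) := funext fun i => h _ ⟨i, rfl⟩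
    simp only [FSat, this]
  | eq x y => simp only [FSat, h x (by simp [fv]), h y (by simp [fv])]
  | neq x y => simp only [FSat, h x (by simp [fv]), h y (by simp [fv])]
  | dep i v => exact i.elim
  | and φ ψ h₁ h₂ =>
    exact and_congr (h₁ fun x hx => h x (.inl hx)) (h₂ fun x hx => h x (.inr hx))
  | or φ ψ h₁ h₂ =>
    exact or_congr (h₁ fun x hx => h x (.inl hx)) (h₂ fun x hx => h x (.inr hx))
  | gdisj φ ψ h₁ h₂ =>
    exact or_congr (h₁ fun x hx => h x (.inl hx)) (h₂ fun x hx => h x (.inr hx))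
  | cneg φ ih => exact not_congr (ih h)
  | ex v φ ih => exact exists_congr fun m => ih (update_eq_of_mem_diff h m)
  | al v φ ih => exact forall_congr' fun m => ih (update_eq_of_mem_diff h m)

theorem IsSentence.fSat_iff {φ : FOF S} (hφ : IsSentence φ) (I : Interp S M) (s : ℕ → M) :
    FSat M I s φ ↔ FOTrue M I φ := by
  refine ⟨fun h t => (FSat_congr I φ fun x hx => ?_).1 h, fun h => h s⟩
  rw [hφ] at hx
  exact hx.elim

theorem FSat_equiv {M N : Type} (f : M ≃ N) (θ : EF) (s : ℕ → M) :
    FSat M (eI M) s θ ↔ FSat N (eI N) (f ∘ s) θ := by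
  induction θ generalizing s with
  | rel r v => exact Empty.elim r
  | nrel r v => exact Empty.elim r
  | eq x y => simp [FSat]
  | neq x y => simp [FSat]
  | dep i v => exact i.elim
  | and φ ψ h₁ h₂ => exact and_congr (h₁ s) (h₂ s)
  | or φ ψ h₁ h₂ => exact or_congr (h₁ s) (h₂ s)
  | gdisj φ ψ h₁ h₂ => exact or_congr (h₁ s) (h₂ s)
  | cneg φ ih => exact not_congr (ih s)
  | ex v φ ih =>
    simp only [FSat, ih, Function.comp_update]
    exact f.exists_congr_left.trans (by simp)
  | al v φ ih =>
    simp only [FSat, ih, Function.comp_update]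
    exact f.forall_congr_left.trans (by simp)

theorem fv_exs {ι : Type} {ar : ι → ℕ} (l : List ℕ) (φ : TS S ι ar) :
    fv (exs l φ) = fv φ \ {x | x ∈ l} := by
  induction l with
  | nil => simp [exs]
  | cons v l ih =>
    have : fv (exs (v :: l) φ) = fv (exs l φ) \ {v} := rfl
    rw [this, ih]
    ext x
    simp
    tauto

theorem FSat_exs (I : Interp S M) (l : List ℕ) (φ : FOF S) (s : ℕ → M) :
    FSat M I s (exs l φ) ↔ ∃ t : ℕ → M, (∀ x ∉ l, t x = s x) ∧ FSat M I t φ := by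
  induction l generalizing s with
  | nil =>
    refine ⟨fun h => ⟨s, by simp, h⟩, ?_⟩
    rintro ⟨t, ht, h⟩
    obtain rfl : t = s := funext fun x => ht x (by simp)
    exact h
  | cons v l ih =>
    have : FSat M I s (exs (v :: l) φ) ↔ ∃ m, FSat M I (Function.update s v m) (exs l φ) :=
      Iff.rfl
    simp only [this, ih]
    constructor
    · rintro ⟨m, t, ht, h⟩
      refine ⟨t, fun x hx => ?_, h⟩
      simp only [List.mem_cons, not_or] at hx
      simp [ht x hx.2, hx.1]
    · rintro ⟨t, ht, h⟩
      refine ⟨t v, t, fun x hx => ?_, h⟩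
      by_cases hxv : x = v
      · subst hxv; simp
      · simp [hxv, ht x (by simp [hxv, hx])]

/-- The existential closure of a first-order formula. -/
theorem exists_sentence_iff_exists_FSat (χ : FOF S) :
    ∃ ψ : FOF S, IsSentence ψ ∧ ∀ (M : Type), Nontrivial M → ∀ I : Interp S M,
      (FOTrue M I ψ ↔ ∃ s, FSat M I s χ) := by
  classical
  obtain ⟨l, hl⟩ : ∃ l : List ℕ, ∀ x, x ∈ l ↔ x ∈ fv χ :=
    ⟨(fv_finite χ).toFinset.toList, by simp⟩
  refine ⟨exs l χ, ?_, fun M _ I => ⟨fun h => ?_, ?_⟩⟩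
  · rw [IsSentence, fv_exs]
    ext x
    simp [hl]
  · obtain ⟨m, -⟩ := exists_pair_ne M
    obtain ⟨t, -, ht⟩ := (FSat_exs I l χ _).1 (h fun _ => m)
    exact ⟨t, ht⟩
  · rintro ⟨t, ht⟩ s
    refine (FSat_exs I l χ s).2 ⟨fun x => if x ∈ l then t x else s x, ?_, ?_⟩
    · intro x hx; simp [hx]
    · exact (FSat_congr I χ fun x hx => by simp [(hl x).2 hx]).1 ht

/-- The conjunction of the formulas of `l` and of `χ`. -/
def conj (l : List (FOF S)) (χ : FOF S) : FOF S := l.foldr TS.and χ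

theorem FSat_conj (I : Interp S M) (l : List (FOF S)) (χ : FOF S) (s : ℕ → M) :
    FSat M I s (conj l χ) ↔ (∀ φ ∈ l, FSat M I s φ) ∧ FSat M I s χ := by
  induction l with
  | nil => simp [conj]
  | cons φ l ih =>
    have : FSat M I s (conj (φ :: l) χ) ↔ FSat M I s φ ∧ FSat M I s (conj l χ) := Iff.rfl
    simp [this, ih, and_assoc]

theorem fv_conj_subset {F : Set ℕ} (l : List (FOF S)) {χ : FOF S} (hχ : fv χ ⊆ F)
    (h : ∀ φ ∈ l, fv φ ⊆ F) : fv (conj l χ) ⊆ F := by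
  induction l with
  | nil => exact hχ
  | cons φ l ih =>
    exact Set.union_subset (h φ (by simp)) (ih fun χ hχ => h χ (by simp [hχ]))

end FirstOrder

section Flat

variable {S : Signature} {ι : Type} {ar : ι → ℕ}

/-- The negation normal form of a first-order formula (`b = true`) or of its negation
(`b = false`), as a team-semantics formula. -/
def nnf : Bool → FOF S → TS S ι ar
  | true, .rel r v => .rel r v
  | false, .rel r v => .nrel r v
  | true, .nrel r v => .nrel r v
  | false, .nrel r v => .rel r v
  | true, .eq x y => .eq x y
  | false, .eq x y => .neq x y
  | true, .neq x y => .neq x y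
  | false, .neq x y => .eq x y
  | _, .dep i _ => Empty.elim i
  | true, .and φ ψ => .and (nnf true φ) (nnf true ψ)
  | false, .and φ ψ => .or (nnf false φ) (nnf false ψ)
  | true, .or φ ψ => .or (nnf true φ) (nnf true ψ)
  | false, .or φ ψ => .and (nnf false φ) (nnf false ψ)
  | true, .gdisj φ ψ => .or (nnf true φ) (nnf true ψ)
  | false, .gdisj φ ψ => .and (nnf false φ) (nnf false ψ)
  | b, .cneg φ => nnf (!b) φ
  | true, .ex v φ => .ex v (nnf true φ)
  | false, .ex v φ => .al v (nnf false φ)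
  | true, .al v φ => .al v (nnf true φ)
  | false, .al v φ => .ex v (nnf false φ)

theorem fv_nnf (b : Bool) (φ : FOF S) : fv (nnf b φ : TS S ι ar) = fv φ := by
  induction φ generalizing b with
  | dep i v => exact Empty.elim i
  | _ => cases b <;> simp_all [nnf, fv]

theorem plain_nnf (b : Bool) (φ : FOF S) : Plain (nnf b φ : TS S ι ar) := by
  unfold Plain
  induction φ generalizing b with
  | dep i v => exact Empty.elim i
  | _ => cases b <;> simp_all [nnf, NoCneg, NoGdisj]

variable {M : Type}

theorem exists_cover_iff {X : Set (ℕ → M)} {p q : (ℕ → M) → Prop} :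
    (∃ Y Z : Set (ℕ → M), Y ∪ Z = X ∧ (∀ s ∈ Y, p s) ∧ ∀ s ∈ Z, q s) ↔
      ∀ s ∈ X, p s ∨ q s := by
  constructor
  · rintro ⟨Y, Z, rfl, hY, hZ⟩ s (hs | hs)
    exacts [.inl (hY s hs), .inr (hZ s hs)]
  · intro h
    refine ⟨{s ∈ X | p s}, {s ∈ X | q s}, ?_, fun s hs => hs.2, fun s hs => hs.2⟩
    ext s
    have := h s
    simp only [Set.mem_union, Set.mem_ofPred_eq]
    tauto

theorem exists_choice_iff {X : Set (ℕ → M)} {p : (ℕ → M) → Prop} {v : ℕ} :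
    (∃ H : (ℕ → M) → Set M, (∀ s ∈ X, (H s).Nonempty) ∧
      ∀ s' ∈ {s' | ∃ s ∈ X, ∃ m ∈ H s, s' = Function.update s v m}, p s') ↔
      ∀ s ∈ X, ∃ m, p (Function.update s v m) := by
  constructor
  · rintro ⟨H, hH, h⟩ s hs
    obtain ⟨m, hm⟩ := hH s hs
    exact ⟨m, h _ ⟨s, hs, m, hm, rfl⟩⟩
  · intro h
    refine ⟨fun s => {m | p (Function.update s v m)}, h, ?_⟩
    rintro _ ⟨s, hs, m, hm, rfl⟩
    exact hm

theorem forall_update_iff {X : Set (ℕ → M)} {p : (ℕ → M) → Prop} {v : ℕ} :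
    (∀ s' ∈ {s' | ∃ s ∈ X, ∃ m, s' = Function.update s v m}, p s') ↔
      ∀ s ∈ X, ∀ m, p (Function.update s v m) := by
  constructor
  · exact fun h s hs m => h _ ⟨s, hs, m, rfl⟩
  · rintro h _ ⟨s, hs, m, rfl⟩
    exact h s hs m

/-- First-order formulas are flat. -/
theorem TSat_nnf (I : Interp S M) (A : ∀ i, Set (Fin (ar i) → M) → Prop) (b : Bool)
    (φ : FOF S) (X : Set (ℕ → M)) :
    TSat M I A (nnf b φ) X ↔ ∀ s ∈ X, (FSat M I s φ ↔ b = true) := by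
  induction φ generalizing b X with
  | dep i v => exact Empty.elim i
  | and φ ψ h₁ h₂ | or φ ψ h₁ h₂ | gdisj φ ψ h₁ h₂ =>
    cases b <;>
      simp only [nnf, TSat, FSat, h₁, h₂, exists_cover_iff, iff_true, Bool.false_eq_true,
        iff_false, not_and_or, not_or, imp_and, forall_and]
  | ex v φ ih | al v φ ih =>
    cases b <;>
      simp only [nnf, TSat, FSat, ih, exists_choice_iff, forall_update_iff, iff_true,
        Bool.false_eq_true, iff_false, not_exists, not_forall]
  | cneg φ ih => cases b <;> simp [nnf, FSat, ih]
  | _ => cases b <;> simp [nnf, TSat, FSat]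

end Flat

section Expansion

/-- The expansion of a signature by unary predicate symbols indexed by `α`. -/
def addUnary (S : Signature) (α : Type) : Signature := fun n => S n ⊕ (PLift (n = 1) × α)

variable {S : Signature} {α : Type} {M : Type}

/-- The expansion of an interpretation by the subsets `U i` of the domain. -/
def expand (I : Interp S M) (U : α → Set M) : Interp (addUnary S α) M := fun n r =>
  match r with
  | .inl r => I n r
  | .inr p => {f | ∀ j : Fin n, f j ∈ U p.2}

/-- The unary predicate symbol with index `i`. -/
def unaryPred (i : α) : addUnary S α 1 := .inr (⟨rfl⟩, i)

theorem pSet_expand_unaryPred (I : Interp S M) (U : α → Set M) (i : α) :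
    PSet (expand I U) (unaryPred i) = U i := by
  ext m
  simp [PSet, expand, unaryPred]

/-- Replace the atom `P i z` by `τ i z`, renaming each variable `v` to `2 * v + 1`. -/
def eliminateUnary (τ : α → ℕ → FOF S) : FOF (addUnary S α) → FOF S
  | .rel (.inl r) v => .rel r fun j => 2 * v j + 1
  | .rel (.inr p) v => τ p.2 (2 * v ⟨0, p.1.down ▸ Nat.one_pos⟩ + 1)
  | .nrel (.inl r) v => .nrel r fun j => 2 * v j + 1
  | .nrel (.inr p) v => .cneg (τ p.2 (2 * v ⟨0, p.1.down ▸ Nat.one_pos⟩ + 1))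
  | .eq x y => .eq (2 * x + 1) (2 * y + 1)
  | .neq x y => .neq (2 * x + 1) (2 * y + 1)
  | .dep i _ => Empty.elim i
  | .and φ ψ => .and (eliminateUnary τ φ) (eliminateUnary τ ψ)
  | .or φ ψ => .or (eliminateUnary τ φ) (eliminateUnary τ ψ)
  | .gdisj φ ψ => .gdisj (eliminateUnary τ φ) (eliminateUnary τ ψ)
  | .cneg φ => .cneg (eliminateUnary τ φ)
  | .ex v φ => .ex (2 * v + 1) (eliminateUnary τ φ)
  | .al v φ => .al (2 * v + 1) (eliminateUnary τ φ)

theorem update_odd (s : ℕ → M) (v : ℕ) (m : M) :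
    (fun x => Function.update s (2 * v + 1) m (2 * x + 1)) =
      Function.update (fun x => s (2 * x + 1)) v m := by
  ext x
  by_cases h : x = v
  · subst h; simp
  · simp [h]

theorem FSat_eliminateUnary (I : Interp S M) (U : α → Set M) (τ : α → ℕ → FOF S)
    (φ : FOF (addUnary S α)) (s : ℕ → M)
    (hτ : ∀ t : ℕ → M, (∀ n, t (2 * n) = s (2 * n)) → ∀ i z,
      FSat M I t (τ i z) ↔ t z ∈ U i) :
    FSat M I s (eliminateUnary τ φ) ↔
      FSat M (expand I U) (fun x => s (2 * x + 1)) φ := by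
  induction φ generalizing s with
  | @rel n r v =>
    rcases r with r | ⟨⟨rfl⟩, i⟩
    · exact Iff.rfl
    · simp only [eliminateUnary, hτ s fun _ => rfl]
      exact ⟨fun h j => by rwa [Subsingleton.elim j 0], fun h => h 0⟩
  | @nrel n r v =>
    rcases r with r | ⟨⟨rfl⟩, i⟩
    · exact Iff.rfl
    · simp only [eliminateUnary, FSat, hτ s fun _ => rfl]
      exact not_congr ⟨fun h j => by rwa [Subsingleton.elim j 0], fun h => h 0⟩
  | eq x y => exact Iff.rfl
  | neq x y => exact Iff.rfl
  | dep i v => exact Empty.elim i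
  | and φ ψ h₁ h₂ => exact and_congr (h₁ s hτ) (h₂ s hτ)
  | or φ ψ h₁ h₂ => exact or_congr (h₁ s hτ) (h₂ s hτ)
  | gdisj φ ψ h₁ h₂ => exact or_congr (h₁ s hτ) (h₂ s hτ)
  | cneg φ ih => exact not_congr (ih s hτ)
  | ex v φ ih =>
    simp only [eliminateUnary, FSat, ← update_odd]
    refine exists_congr fun m => ih _ fun t ht => hτ t fun n => ?_
    rw [ht, Function.update_of_ne (by omega)]
  | al v φ ih =>
    simp only [eliminateUnary, FSat, ← update_odd]
    refine forall_congr' fun m => ih _ fun t ht => hτ t fun n => ?_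
    rw [ht, Function.update_of_ne (by omega)]

end Expansion

section Relativization

variable {S : Signature} {M : Type}

/-- The relativization of `θ` to `P`, with all variables shifted by `K`. -/
def relativize (P : S 1) (K : ℕ) : EF → FOF S
  | .rel r _ => Empty.elim r
  | .nrel r _ => Empty.elim r
  | .eq x y => .eq (x + K) (y + K)
  | .neq x y => .neq (x + K) (y + K)
  | .dep i _ => Empty.elim i
  | .and φ ψ => .and (relativize P K φ) (relativize P K ψ)
  | .or φ ψ => .or (relativize P K φ) (relativize P K ψ)
  | .gdisj φ ψ => .gdisj (relativize P K φ) (relativize P K ψ)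
  | .cneg φ => .cneg (relativize P K φ)
  | .ex v φ => .ex (v + K) (.and (.rel P fun _ => v + K) (relativize P K φ))
  | .al v φ => .al (v + K) (.or (.nrel P fun _ => v + K) (relativize P K φ))

theorem FSat_relativize (I : Interp S M) (P : S 1) (K : ℕ) (θ : EF) (c : ℕ → PSet I P)
    (s : ℕ → M) (h : ∀ z ∈ fv θ, s (z + K) = c z) :
    FSat M I s (relativize P K θ) ↔ FSat (PSet I P) (eI _) c θ := by
  have key : ∀ (v : ℕ) (φ : EF) (c : ℕ → PSet I P) (s : ℕ → M),
      (∀ z ∈ fv φ \ {v}, s (z + K) = c z) → ∀ m : PSet I P, ∀ z ∈ fv φ,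
        Function.update s (v + K) (m : M) (z + K) = (Function.update c v m z : M) := by
    intro v φ c s h m z hz
    by_cases hzv : z = v
    · subst hzv; simp
    · simpa [hzv] using h z ⟨hz, hzv⟩
  induction θ generalizing c s with
  | rel r v => exact Empty.elim r
  | nrel r v => exact Empty.elim r
  | eq x y => simp [relativize, FSat, h x (by simp [fv]), h y (by simp [fv]), Subtype.ext_iff]
  | neq x y => simp [relativize, FSat, h x (by simp [fv]), h y (by simp [fv]), Subtype.ext_iff]
  | dep i v => exact Empty.elim i
  | and φ ψ h₁ h₂ =>
    exact and_congr (h₁ c s fun x hx => h x (.inl hx)) (h₂ c s fun x hx => h x (.inr hx))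
  | or φ ψ h₁ h₂ =>
    exact or_congr (h₁ c s fun x hx => h x (.inl hx)) (h₂ c s fun x hx => h x (.inr hx))
  | gdisj φ ψ h₁ h₂ =>
    exact or_congr (h₁ c s fun x hx => h x (.inl hx)) (h₂ c s fun x hx => h x (.inr hx))
  | cneg φ ih => exact not_congr (ih c s h)
  | ex v φ ih =>
    simp only [relativize, FSat, Function.update_self]
    constructor
    · rintro ⟨m, hm, hφ⟩
      exact ⟨⟨m, hm⟩, (ih _ _ (key v φ c s h ⟨m, hm⟩)).1 hφ⟩
    · rintro ⟨m, hφ⟩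
      exact ⟨m, m.2, (ih _ _ (key v φ c s h m)).2 hφ⟩
  | al v φ ih =>
    simp only [relativize, FSat, Function.update_self]
    constructor
    · intro hφ m
      exact (ih _ _ (key v φ c s h m)).1 ((hφ m).resolve_left fun hm => hm m.2)
    · intro hφ m
      by_cases hm : m ∈ PSet I P
      · exact .inr ((ih _ _ (key v φ c s h ⟨m, hm⟩)).2 (hφ ⟨m, hm⟩))
      · exact .inl hm

theorem fv_relativize (P : S 1) (K : ℕ) (θ : EF) :
    fv (relativize P K θ) ⊆ (· + K) '' fv θ := by
  have diff : ∀ (v : ℕ) (F : Set ℕ) (G : Set ℕ), F ⊆ (· + K) '' G →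
      ({v + K} ∪ F) \ {v + K} ⊆ (· + K) '' (G \ {v}) := by
    rintro v F G h x ⟨hx | hx, hxv⟩
    · exact (hxv hx).elim
    · obtain ⟨z, hz, rfl⟩ := h hx
      exact ⟨z, ⟨hz, fun hzv => hxv (by simp_all)⟩, rfl⟩
  induction θ with
  | rel r v => exact Empty.elim r
  | nrel r v => exact Empty.elim r
  | eq x y => simp [relativize, fv, Set.image_pair]
  | neq x y => simp [relativize, fv, Set.image_pair]
  | dep i v => exact Empty.elim i
  | and φ ψ h₁ h₂ | or φ ψ h₁ h₂ | gdisj φ ψ h₁ h₂ =>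
    simp only [relativize, fv, Set.image_union]
    exact Set.union_subset_union h₁ h₂
  | cneg φ ih => exact ih
  | ex v φ ih | al v φ ih =>
    simp only [relativize, fv, Set.range_const]
    exact diff v _ _ ih

end Relativization

section Translation

variable {S T : Signature} {k : ℕ} {M : Type}

/-- A formula all of whose free variables are among `v`, stating that the tuple of the values of
`v` and of the elements named by the predicates `e k, …, e (N - 1)` lies in `P` and satisfies `θ`
there. -/
def paramFormula (P : S 1) (θ : EF) (N : ℕ) (e : ℕ → ℕ) (v : Fin k → ℕ) :
    FOF (addUnary S ℕ) :=
  exs ((List.range N).map (· + (∑ j, v j + 1)))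
    (conj ((List.range N).map fun i =>
        .and (.rel (.inl P : addUnary S ℕ 1) fun _ => i + (∑ j, v j + 1))
          (if h : i < k then .eq (i + (∑ j, v j + 1)) (v ⟨i, h⟩)
            else .rel (unaryPred (e i)) fun _ => i + (∑ j, v j + 1)))
      (relativize (.inl P : addUnary S ℕ 1) (∑ j, v j + 1) θ))

theorem fv_paramFormula (P : S 1) (θ : EF) (N : ℕ) (e : ℕ → ℕ) (v : Fin k → ℕ)
    (hN : ∀ z ∈ fv θ, z < N) : fv (paramFormula P θ N e v) ⊆ Set.range v := by
  rw [paramFormula, fv_exs]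
  generalize ∑ j, v j + 1 = K
  rw [Set.sdiff_subset_iff]
  apply fv_conj_subset
  · refine (fv_relativize _ _ θ).trans ?_
    rintro _ ⟨z, hz, rfl⟩
    exact .inl (by simpa using hN z hz)
  · intro φ hφ
    obtain ⟨i, hi, rfl⟩ := List.mem_map.1 hφ
    have hi' : i + K ∈ {x | x ∈ (List.range N).map (· + K)} ∪ Set.range v :=
      .inl (List.mem_map.2 ⟨i, hi, rfl⟩)
    refine Set.union_subset ?_ ?_
    · rintro _ ⟨_, rfl⟩
      exact hi'
    · split_ifs with h
      · rintro x (rfl | rfl)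
        exacts [hi', .inr ⟨_, rfl⟩]
      · rintro _ ⟨_, rfl⟩
        exact hi'

theorem FSat_paramFormula (I : Interp S M) (P : S 1) (θ : EF) {N : ℕ} (e : ℕ → ℕ)
    (v : Fin k → ℕ) (a : ℕ → M) (s : ℕ → M) (hk : k < N) (hN : ∀ z ∈ fv θ, z < N) :
    FSat M (expand I fun i => {a i}) s (paramFormula P θ N e v) ↔
      ∃ c : ℕ → PSet I P,
        (∀ z < N, (c z : M) = overrideFin k (fun j => s (v j)) (a ∘ e) z) ∧
        FSat (PSet I P) (eI _) c θ := by
  rw [paramFormula, FSat_exs]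
  have hv : ∀ j, v j < ∑ j, v j + 1 := fun j =>
    Nat.lt_succ_of_le (Finset.single_le_sum (f := v) (fun _ _ => Nat.zero_le _)
      (Finset.mem_univ j))
  generalize ∑ j, v j + 1 = K at hv
  have hl : ∀ x, x ∈ (List.range N).map (· + K) ↔ K ≤ x ∧ x - K < N := by
    intro x
    simp only [List.mem_map, List.mem_range]
    exact ⟨by rintro ⟨i, hi, rfl⟩; omega, fun h => ⟨x - K, h.2, by omega⟩⟩
  have hlit : ∀ (t : ℕ → M) (i : ℕ), (∀ j, t (v j) = s (v j)) →
      (FSat M (expand I fun i => {a i}) t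
        (.and (.rel (.inl P : addUnary S ℕ 1) fun _ => i + K)
          (if h : i < k then .eq (i + K) (v ⟨i, h⟩)
            else .rel (unaryPred (e i)) fun _ => i + K) : FOF (addUnary S ℕ)) ↔
        t (i + K) ∈ PSet I P ∧
          t (i + K) = overrideFin k (fun j => s (v j)) (a ∘ e) i) := by
    intro t i ht
    refine and_congr Iff.rfl ?_
    by_cases h : i < k
    · simp [h, overrideFin, FSat, ht]
    · simp [h, overrideFin, FSat, expand, unaryPred]
  have hrel : ∀ (c : ℕ → PSet I P) (t : ℕ → M), (∀ z ∈ fv θ, t (z + K) = c z) →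
      (FSat M (expand I fun i => {a i}) t (relativize (.inl P : addUnary S ℕ 1) K θ) ↔
        FSat (PSet I P) (eI _) c θ) :=
    fun c t h => FSat_relativize (expand I fun i => {a i}) (.inl P) K θ c t h
  simp only [FSat_conj, List.forall_mem_map, List.mem_range]
  constructor
  · rintro ⟨t, hts, htN, htθ⟩
    have htv : ∀ j, t (v j) = s (v j) := fun j =>
      hts _ fun h => absurd ((hl _).1 h).1 (not_le.2 (hv j))
    have htN' := fun i hi => (hlit t i htv).1 (htN i hi)
    refine ⟨fun z => if h : z < N then ⟨t (z + K), (htN' z h).1⟩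
      else ⟨t (k + K), (htN' k hk).1⟩, fun z hz => ?_, ?_⟩
    · simpa [hz] using (htN' z hz).2
    · refine (hrel _ t fun z hz => ?_).1 htθ
      simp [hN z hz]
  · rintro ⟨c, hc, hθ⟩
    refine ⟨fun x => if K ≤ x ∧ x - K < N then c (x - K) else s x,
      fun x hx => if_neg fun h => hx ((hl x).2 h), fun i hi => ?_, ?_⟩
    · refine (hlit _ i fun j => if_neg fun h => absurd h.1 (not_le.2 (hv j))).2 ?_
      simp [hi, ← hc i hi]
    · refine (hrel c _ fun z hz => ?_).2 hθ
      simp [hN z hz]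

/-- Translate a formula along a map of signatures, replacing the dependency atoms by
`g e v`, where distinct occurrences get their own reindexing `e` of the parameters. -/
def translate (f : ∀ n, S n → T n)
    (g : (ℕ → ℕ) → (Fin k → ℕ) → TS T Unit (fun _ => k)) :
    (ℕ → ℕ) → TS S Unit (fun _ => k) → TS T Unit (fun _ => k)
  | _, .rel r v => .rel (f _ r) v
  | _, .nrel r v => .nrel (f _ r) v
  | _, .eq x y => .eq x y
  | _, .neq x y => .neq x y
  | e, .dep _ v => g e v
  | e, .and φ ψ => .and (translate f g (fun i => e (2 * i)) φ)
      (translate f g (fun i => e (2 * i + 1)) ψ)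
  | e, .or φ ψ => .or (translate f g (fun i => e (2 * i)) φ)
      (translate f g (fun i => e (2 * i + 1)) ψ)
  | e, .gdisj φ ψ => .gdisj (translate f g (fun i => e (2 * i)) φ)
      (translate f g (fun i => e (2 * i + 1)) ψ)
  | e, .cneg φ => .cneg (translate f g e φ)
  | e, .ex v φ => .ex v (translate f g e φ)
  | e, .al v φ => .al v (translate f g e φ)

theorem fv_translate (f : ∀ n, S n → T n)
    (g : (ℕ → ℕ) → (Fin k → ℕ) → TS T Unit (fun _ => k))
    (hg : ∀ e v, fv (g e v) ⊆ Set.range v) (e : ℕ → ℕ) (φ : TS S Unit (fun _ => k)) :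
    fv (translate f g e φ) ⊆ fv φ := by
  induction φ generalizing e with
  | dep i v => exact hg e v
  | and φ ψ h₁ h₂ | or φ ψ h₁ h₂ | gdisj φ ψ h₁ h₂ =>
    exact Set.union_subset_union (h₁ _) (h₂ _)
  | cneg φ ih => exact ih e
  | ex v φ ih | al v φ ih => exact Set.sdiff_subset_sdiff_left (ih e)
  | _ => exact subset_rfl

theorem isSentence_translate {f : ∀ n, S n → T n}
    {g : (ℕ → ℕ) → (Fin k → ℕ) → TS T Unit (fun _ => k)}
    (hg : ∀ e v, fv (g e v) ⊆ Set.range v) (e : ℕ → ℕ) {φ : TS S Unit (fun _ => k)}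
    (hφ : IsSentence φ) : IsSentence (translate f g e φ) :=
  Set.subset_eq_empty (fv_translate f g hg e φ) hφ

theorem plain_translate {f : ∀ n, S n → T n}
    {g : (ℕ → ℕ) → (Fin k → ℕ) → TS T Unit (fun _ => k)}
    (hg : ∀ e v, Plain (g e v)) (e : ℕ → ℕ) {φ : TS S Unit (fun _ => k)}
    (hφ : Plain φ) : Plain (translate f g e φ) := by
  unfold Plain at *
  induction φ generalizing e with
  | dep i v => exact hg e v
  | _ => simp_all [translate, NoCneg, NoGdisj]

/-- Team semantics in which the dependency atoms are evaluated with respect to parameters,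
with different parameters for different occurrences. -/
def ParamSat (I : Interp S M) (B : (ℕ → M) → (Fin k → ℕ) → Set (ℕ → M) → Prop) :
    (ℕ → M) → TS S Unit (fun _ => k) → Set (ℕ → M) → Prop
  | _, .rel r v, X => ∀ s ∈ X, (fun i => s (v i)) ∈ I _ r
  | _, .nrel r v, X => ∀ s ∈ X, (fun i => s (v i)) ∉ I _ r
  | _, .eq x y, X => ∀ s ∈ X, s x = s y
  | _, .neq x y, X => ∀ s ∈ X, s x ≠ s y
  | b, .dep _ v, X => B b v X
  | b, .and φ ψ, X => ParamSat I B (fun i => b (2 * i)) φ X ∧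
      ParamSat I B (fun i => b (2 * i + 1)) ψ X
  | b, .or φ ψ, X => ∃ Y Z : Set (ℕ → M), Y ∪ Z = X ∧
      ParamSat I B (fun i => b (2 * i)) φ Y ∧ ParamSat I B (fun i => b (2 * i + 1)) ψ Z
  | b, .gdisj φ ψ, X => ParamSat I B (fun i => b (2 * i)) φ X ∨
      ParamSat I B (fun i => b (2 * i + 1)) ψ X
  | b, .cneg φ, X => ¬ ParamSat I B b φ X
  | b, .ex v φ, X => ∃ H : (ℕ → M) → Set M, (∀ s ∈ X, (H s).Nonempty) ∧
      ParamSat I B b φ {s' | ∃ s ∈ X, ∃ m ∈ H s, s' = Function.update s v m}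
  | b, .al v φ, X =>
      ParamSat I B b φ {s' | ∃ s ∈ X, ∃ m : M, s' = Function.update s v m}

theorem TSat_translate (I : Interp S M) (J : Interp T M)
    (A : ∀ _ : Unit, Set (Fin k → M) → Prop)
    (B : (ℕ → M) → (Fin k → ℕ) → Set (ℕ → M) → Prop) (a : ℕ → M)
    (f : ∀ n, S n → T n) (g : (ℕ → ℕ) → (Fin k → ℕ) → TS T Unit (fun _ => k))
    (hf : ∀ n r, J n (f n r) = I n r) (hg : ∀ e v X, TSat M J A (g e v) X ↔ B (a ∘ e) v X)
    (e : ℕ → ℕ) (φ : TS S Unit (fun _ => k)) (X : Set (ℕ → M)) :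
    TSat M J A (translate f g e φ) X ↔ ParamSat I B (a ∘ e) φ X := by
  induction φ generalizing e X with
  | dep i v => exact hg e v X
  | and φ ψ h₁ h₂ | or φ ψ h₁ h₂ | gdisj φ ψ h₁ h₂ =>
    simp only [translate, TSat, ParamSat, h₁, h₂, Function.comp_def]
  | _ => simp_all only [translate, TSat, ParamSat]

/-- Some dependency atom occurs. -/
def HasDep : TS S Unit (fun _ => k) → Prop
  | .dep _ _ => True
  | .and φ ψ | .or φ ψ | .gdisj φ ψ => HasDep φ ∨ HasDep ψ
  | .cneg φ | .ex _ φ | .al _ φ => HasDep φ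
  | _ => False

theorem exists_interleave {p q : (ℕ → M) → Prop} :
    (∃ b : ℕ → M, p (fun i => b (2 * i)) ∧ q fun i => b (2 * i + 1)) ↔
      (∃ b, p b) ∧ ∃ b, q b := by
  constructor
  · rintro ⟨b, hp, hq⟩
    exact ⟨⟨_, hp⟩, _, hq⟩
  · rintro ⟨⟨b, hp⟩, c, hq⟩
    refine ⟨fun i => if i % 2 = 0 then b (i / 2) else c (i / 2), ?_, ?_⟩
    · convert hp using 2 with i
      simp
    · convert hq using 2 with i
      have : (2 * i + 1) / 2 = i := by omega
      simp [this]

/-- If each atom amounts to the existence of suitable parameters, under a side condition `Q`,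
then the parameters can be chosen globally. -/
theorem TSat_iff_exists_paramSat [Nonempty M] (I : Interp S M)
    (A : ∀ _ : Unit, Set (Fin k → M) → Prop)
    (B : (ℕ → M) → (Fin k → ℕ) → Set (ℕ → M) → Prop) (Q : Prop)
    (hAB : ∀ v X, A () (teamProj v X) ↔ Q ∧ ∃ b, B b v X)
    (φ : TS S Unit (fun _ => k)) (hφ : Plain φ) (X : Set (ℕ → M)) :
    TSat M I A φ X ↔ (HasDep φ → Q) ∧ ∃ b, ParamSat I B b φ X := by
  obtain ⟨hc, hd⟩ := hφ
  induction φ generalizing X with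
  | dep i v => simpa [TSat, HasDep, ParamSat] using hAB v X
  | and φ ψ h₁ h₂ =>
    simp only [TSat, h₁ _ hc.1 hd.1, h₂ _ hc.2 hd.2, HasDep, ParamSat,
      exists_interleave (p := fun b => ParamSat I B b φ X)
        (q := fun b => ParamSat I B b ψ X)]
    tauto
  | or φ ψ h₁ h₂ =>
    simp only [TSat, h₁ _ hc.1 hd.1, h₂ _ hc.2 hd.2, HasDep, ParamSat]
    constructor
    · rintro ⟨Y, Z, hX, ⟨hY, hb⟩, hZ, hc⟩
      obtain ⟨b, hb⟩ := (exists_interleave (p := fun b => ParamSat I B b φ Y)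
        (q := fun b => ParamSat I B b ψ Z)).2 ⟨hb, hc⟩
      exact ⟨fun h => h.elim hY hZ, b, Y, Z, hX, hb⟩
    · rintro ⟨hQ, b, Y, Z, hX, h⟩
      exact ⟨Y, Z, hX, ⟨fun h => hQ (.inl h), _, h.1⟩, fun h => hQ (.inr h), _, h.2⟩
  | gdisj φ ψ => exact hd.elim
  | cneg φ => exact hc.elim
  | ex v φ ih =>
    simp only [TSat, ih _ hc hd, HasDep, ParamSat]
    constructor
    · rintro ⟨H, hH, hQ, b, h⟩
      exact ⟨hQ, b, H, hH, h⟩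
    · rintro ⟨hQ, b, H, hH, h⟩
      exact ⟨H, hH, hQ, b, h⟩
  | al v φ ih => simp only [TSat, ih _ hc hd, HasDep, ParamSat]
  | _ => simp [TSat, HasDep, ParamSat]

end Translation

section Restriction

variable {k : ℕ} {D : DepPred k} {θ : EF} {S : Signature} {M : Type}

theorem relSem_restrict_iff (I : Interp S M) (P : S 1) {N : ℕ} (hN : ∀ z ∈ fv θ, z < N)
    (v : Fin k → ℕ) (X : Set (ℕ → M)) :
    relSem (fun M R => D M R ∧ ExAllSem M R θ) P M I (teamProj v X) ↔
      (PSet I P).Nonempty ∧ ∃ b : ℕ → M, relSem D P M I (teamProj v X) ∧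
        ∀ s ∈ X, ∃ c : ℕ → PSet I P,
          (∀ z < N, (c z : M) = overrideFin k (fun j => s (v j)) b z) ∧
          FSat (PSet I P) (eI _) c θ := by
  classical
  constructor
  · rintro ⟨hP, hD, t, ht⟩
    refine ⟨⟨t 0, (t 0).2⟩, fun z => t z, ⟨hP, hD⟩, fun s hs => ?_⟩
    have hsP : ∀ j, s (v j) ∈ PSet I P := hP _ ⟨s, hs, rfl⟩
    refine ⟨overrideFin k (fun j => ⟨s (v j), hsP j⟩) t, fun z _ => ?_, ht _ ⟨s, hs, rfl⟩⟩
    by_cases hz : z < k <;> simp [overrideFin, hz]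
  · rintro ⟨⟨p, hp⟩, b, ⟨hP, hD⟩, hb⟩
    refine ⟨hP, hD, fun z => if h : b z ∈ PSet I P then ⟨b z, h⟩ else ⟨p, hp⟩, ?_⟩
    rintro f ⟨s, hs, hf⟩
    obtain ⟨c, hc, hθ⟩ := hb s hs
    refine (FSat_congr _ θ fun z hz => ?_).1 hθ
    have hcz := hc z (hN z hz)
    apply Subtype.ext
    by_cases hzk : z < k
    · simpa [overrideFin, hzk, hcz] using (congrFun hf ⟨z, hzk⟩).symm
    · simp only [overrideFin, hzk, dite_false] at hcz ⊢
      have hbz : b z ∈ PSet I P := hcz ▸ (c z).2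
      simp [hbz, hcz]

/-- Sentences with atoms for the relativized restriction of `D` are first order. -/
theorem exists_firstOrder_of_relSem_restrict (hsfo : SFOd D) (hrel : Relativizable1 D)
    (P : S 1) (φ : TS S Unit (fun _ => k)) (hφ : IsSentence φ) (hφp : Plain φ) :
    ∃ ψ : FOF S, IsSentence ψ ∧ ∀ (M : Type), Nontrivial M → ∀ I : Interp S M,
      (TTrue M I (fun _ => relSem (fun M R => D M R ∧ ExAllSem M R θ) P M I) φ ↔
        FOTrue M I ψ) := by
  classical
  obtain ⟨N, hkN, hN⟩ : ∃ N, k < N ∧ ∀ z ∈ fv θ, z < N := by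
    obtain ⟨b, hb⟩ := (fv_finite θ).bddAbove
    exact ⟨k + b + 1, by omega, fun z hz => by have := hb hz; omega⟩
  set g : (ℕ → ℕ) → (Fin k → ℕ) → TS (addUnary S ℕ) Unit (fun _ => k) := fun e v =>
    .and (.dep () v) (nnf true (paramFormula P θ N e v))
  have hgv : ∀ e v, fv (g e v) ⊆ Set.range v := fun e v =>
    Set.union_subset subset_rfl (by
      rw [fv_nnf]
      exact fv_paramFormula P θ N e v hN)
  have hgp : ∀ e v, Plain (g e v) := fun e v =>
    ⟨⟨trivial, (plain_nnf _ _).1⟩, trivial, (plain_nnf _ _).2⟩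
  obtain ⟨φ₁, h₁, hp₁, hφ₁⟩ := hrel (addUnary S ℕ) (.inl P)
    (translate (fun _ => .inl) g id φ) (isSentence_translate hgv id hφ)
    (plain_translate hgp id hφp)
  obtain ⟨φ₂, h₂, hφ₂⟩ := hsfo (addUnary S ℕ) φ₁ h₁ hp₁
  obtain ⟨ψ, hψ, hψφ⟩ := exists_sentence_iff_exists_FSat
    (.and (eliminateUnary (fun i z => .eq z (2 * i)) φ₂)
      (if HasDep φ then .ex 0 (.rel P fun _ => 0) else .eq 0 0) : FOF S)
  refine ⟨ψ, hψ, fun M hM I => ?_⟩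
  have hdep : ∀ s, FSat M I s
      (if HasDep φ then .ex 0 (.rel P fun _ => 0) else .eq 0 0 : FOF S) ↔
        (HasDep φ → (PSet I P).Nonempty) := by
    intro s
    by_cases h : HasDep φ
    · simp [h, FSat, PSet, Set.Nonempty]
    · simp [h, FSat]
  have hsub : ∀ s, FSat M I s (eliminateUnary (fun i z => .eq z (2 * i)) φ₂) ↔
      FOTrue M (expand I fun i => {s (2 * i)}) φ₂ := fun s => by
    rw [FSat_eliminateUnary I (fun i => {s (2 * i)}) _ φ₂ s
      (fun t ht i z => by simp [FSat, ht]), h₂.fSat_iff]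
  rw [hψφ M hM I, TTrue, TSat_iff_exists_paramSat I _ _ _
    (fun v X => relSem_restrict_iff I P hN v X) φ hφp]
  have hpar : ∀ b : ℕ → M, FOTrue M (expand I fun i => {b i}) φ₂ ↔ ParamSat I
      (fun b v X => relSem D P M I (teamProj v X) ∧ ∀ s ∈ X, ∃ c : ℕ → PSet I P,
        (∀ z < N, (c z : M) = overrideFin k (fun j => s (v j)) b z) ∧
        FSat (PSet I P) (eI _) c θ) b φ Set.univ := by
    intro b
    rw [← hφ₂ M hM, ← hφ₁ M hM]
    refine TSat_translate I _ _ _ b _ g (fun _ _ => rfl) (fun e v X => ?_) id φ Set.univ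
    refine and_congr Iff.rfl ?_
    simp only [TSat_nnf, iff_true, FSat_paramFormula I P θ e v b _ hkN hN]
  simp only [FSat, hdep, hsub, ← hpar]
  constructor
  · rintro ⟨hQ, b, hb⟩
    exact ⟨fun x => b (x / 2), by simpa using hb, hQ⟩
  · rintro ⟨s, hs, hQ⟩
    exact ⟨hQ, _, hs⟩

theorem isoClosed_restrict (hiso : IsoClosed D) :
    IsoClosed fun M (R : Set (Fin k → M)) => D M R ∧ ExAllSem M R θ := by
  rintro M N f R ⟨hD, s, hs⟩
  refine ⟨hiso M N f R hD, f ∘ s, ?_⟩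
  rintro _ ⟨t, ht, rfl⟩
  have := (FSat_equiv f θ _).1 (hs t ht)
  convert this using 2
  ext z
  by_cases hz : z < k <;> simp [overrideFin, hz]

/-- Relativization to the whole domain is trivial. -/
theorem relSem_iff_of_pSet_eq_univ (hiso : IsoClosed D) (I : Interp S M) (P : S 1)
    (hP : PSet I P = Set.univ) (R : Set (Fin k → M)) : relSem D P M I R ↔ D M R := by
  have hmem : ∀ m, m ∈ PSet I P := fun m => hP ▸ Set.mem_univ m
  let f : PSet I P ≃ M := Equiv.subtypeUnivEquiv hmem
  constructor
  · rintro ⟨-, h⟩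
    convert hiso _ _ f _ h
    ext t
    exact ⟨fun ht => ⟨fun j => ⟨t j, hmem _⟩, ht, rfl⟩, by rintro ⟨g, hg, rfl⟩; exact hg⟩
  · intro h
    refine ⟨fun t _ j => hmem _, ?_⟩
    convert hiso _ _ f.symm _ h
    ext t
    exact ⟨fun ht => ⟨fun j => t j, ht, rfl⟩, by rintro ⟨g, hg, rfl⟩; exact hg⟩

/-- An isomorphism-closed dependency is strongly first order as soon as the sentences with atoms
for its relativizations are first order. -/
theorem sfod_of_relSem (hiso : IsoClosed D)
    (h : ∀ (S : Signature) (P : S 1) (φ : TS S Unit (fun _ => k)), IsSentence φ → Plain φ →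
      ∃ ψ : FOF S, IsSentence ψ ∧ ∀ (M : Type), Nontrivial M → ∀ I : Interp S M,
        (TTrue M I (fun _ => relSem D P M I) φ ↔ FOTrue M I ψ)) : SFOd D := by
  intro S φ hφ hφp
  obtain ⟨ψ₁, h₁, hψ₁⟩ := h (addUnary S Unit) (unaryPred ())
    (translate (fun _ => .inl) (fun _ v => .dep () v) id φ)
    (isSentence_translate (fun _ _ => subset_rfl) id hφ)
    (plain_translate (fun _ _ => by simp [Plain, NoCneg, NoGdisj]) id hφp)
  obtain ⟨ψ, hψ, hψφ⟩ :=
    exists_sentence_iff_exists_FSat (eliminateUnary (fun _ z => .eq z z) ψ₁ : FOF S)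
  refine ⟨ψ, hψ, fun M hM I => ?_⟩
  have hdep := relSem_iff_of_pSet_eq_univ hiso _ _
    (pSet_expand_unaryPred I (fun _ : Unit => (Set.univ : Set M)) ())
  have hpar := fun a : ℕ → M => TSat_translate I (expand I fun _ : Unit => (Set.univ : Set M))
    (fun _ => relSem D (unaryPred ()) M _) (fun _ v X => D M (teamProj v X)) a (fun _ => .inl)
    (fun _ v => .dep () v) (fun _ _ => rfl) (fun e v X => hdep _) id φ Set.univ
  rw [hψφ M hM I, TTrue, TSat_iff_exists_paramSat I _ (fun _ v X => D M (teamProj v X)) True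
    (by simp) φ hφp]
  simp only [Function.comp_id] at hpar
  have hsub : ∀ s, FSat M I s (eliminateUnary (fun _ z => .eq z z) ψ₁) ↔
      FOTrue M (expand I fun _ : Unit => (Set.univ : Set M)) ψ₁ := fun s => by
    rw [FSat_eliminateUnary I (fun _ => Set.univ) _ ψ₁ s (fun t _ i z => by simp [FSat]),
      h₁.fSat_iff]
  simp only [← hpar, hsub, exists_const, implies_true, true_and]
  exact hψ₁ M hM _

end Restriction

/-- For `D` strongly first order and relativizable and `θ(x̄, ȳ)`
a first-order formula over the empty signature, the dependency
`D_θ = {(M,R) ∈ D : (M,R) ⊨ ∃ȳ ∀x̄ (R x̄ → θ(x̄, ȳ))}` is also strongly first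
order and relativizable. -/
theorem restricted_dependency_sfo {k : ℕ} (D : DepPred k)
    (hiso : IsoClosed D) (hsfo : SFOd D) (hrel : Relativizable1 D) (θ : EF) :
    SFOd (fun M R => D M R ∧ ExAllSem M R θ) ∧
    Relativizable1 (fun M R => D M R ∧ ExAllSem M R θ) := by
  refine ⟨sfod_of_relSem (isoClosed_restrict hiso) fun S P φ hφ hφp =>
    exists_firstOrder_of_relSem_restrict hsfo hrel P φ hφ hφp, fun S P φ hφ hφp => ?_⟩
  obtain ⟨ψ, hψ, h⟩ := exists_firstOrder_of_relSem_restrict (θ := θ) hsfo hrel P φ hφ hφp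
  refine ⟨nnf true ψ, ?_, plain_nnf _ _, fun M hM I => (h M hM I).trans ?_⟩
  · rw [IsSentence, fv_nnf]
    exact hψ
  · simp [TTrue, TSat_nnf, FOTrue]

end DSFO
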